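/- arXiv:cond-mat/0202356 — 2 statements merged into one kernel-verified Lean document; each statement's English description precedes it below -/
import Mathlib

section
/- Let Y and ε be independent real random variables on a probability space (Ω, 𝒜, ℙ), let β > 0 and set X = β·Y + ε. Assume Y has a probability density P_Y with F_Y(y) < 1 for all y; that M := sup_{y > 0} y·P_Y(y)/F̄_Y(y) is finite; and (H2) there exist t₀ > 0, δ > 0 and A > 0 such that F̄_Y(t·x)/F̄_Y(t) ≤ A·x^{−δ} for all t ≥ t₀ and x ≥ 1. For u ∈ (0, 1) with F_Y⁻¹(u) > 0 define f_u(x) = (F_Y⁻¹(u)/(1 − u)) · P_Y(F_Y⁻¹(u)·x) · F̄_ε(F_X⁻¹(u) − β·F_Y⁻¹(u)·x). Then there exists u₀ ∈ (0, 1) such that for all u ∈ [u₀, 1) and all x ≥ 1, f_u(x) ≤ M·A·x^{−(1+δ)}; in particular the family (f_u) is dominated on [1, ∞) by a Lebesgue-integrable function independent of u. -/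
open MeasureTheory ProbabilityTheory Filter Set Topology

/-- Cumulative distribution function of a real random variable. -/
noncomputable def cdf' {Ω : Type*} [MeasureSpace Ω] (Z : Ω → ℝ) (z : ℝ) : ℝ :=
  (ℙ {ω | Z ω ≤ z}).toReal

/-- Survival function `F̄_Z = 1 - F_Z`. -/
noncomputable def surv {Ω : Type*} [MeasureSpace Ω] (Z : Ω → ℝ) (z : ℝ) : ℝ :=
  1 - cdf' Z z

/-- Generalized inverse (quantile function) `F_Z⁻¹(u) = inf {z | F_Z z ≥ u}`. -/
noncomputable def quant {Ω : Type*} [MeasureSpace Ω] (Z : Ω → ℝ) (u : ℝ) : ℝ :=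
  sInf {z : ℝ | u ≤ cdf' Z z}

/-- Conditional probability `ℙ(A | B)`. -/
noncomputable def condP {Ω : Type*} [MeasureSpace Ω] (A B : Set Ω) : ℝ :=
  (ℙ (A ∩ B)).toReal / (ℙ B).toReal

theorem cdf'_eq_cdf {Ω : Type*} [MeasureSpace Ω] [IsProbabilityMeasure (ℙ : Measure Ω)]
    (Y : Ω → ℝ) (hYm : Measurable Y) (y : ℝ) :
    cdf' Y y = ProbabilityTheory.cdf (Measure.map Y ℙ) y := by
  haveI : IsProbabilityMeasure (Measure.map Y (ℙ : Measure Ω)) :=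
    Measure.isProbabilityMeasure_map hYm.aemeasurable
  rw [ProbabilityTheory.cdf_eq_real, Measure.real, Measure.map_apply hYm measurableSet_Iic]
  rfl

/-- Uniform domination of the family `f_u` on `[1, ∞)` by the integrable function
`M·A·x^{-(1+δ)}`, for `u` close enough to `1`. -/
theorem fu_dominated
    {Ω : Type*} [MeasureSpace Ω] [IsProbabilityMeasure (ℙ : Measure Ω)]
    (Y ε X : Ω → ℝ) (hYm : Measurable Y) (hεm : Measurable ε)
    (hindep : IndepFun Y ε ℙ)
    (β : ℝ) (hβ : 0 < β)
    (hXdef : ∀ ω, X ω = β * Y ω + ε ω)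
    (hFY : ∀ y : ℝ, cdf' Y y < 1)
    (P_Y : ℝ → ℝ) (hPm : Measurable P_Y) (hPnn : ∀ y, 0 ≤ P_Y y)
    (hdens : Measure.map Y ℙ
      = (volume : Measure ℝ).withDensity (fun y => ENNReal.ofReal (P_Y y)))
    (M : ℝ) (hMdef : M = sSup {r : ℝ | ∃ y > (0:ℝ), r = y * P_Y y / surv Y y})
    (hMfin : BddAbove {r : ℝ | ∃ y > (0:ℝ), r = y * P_Y y / surv Y y})
    (t₀ δ A : ℝ) (ht₀ : 0 < t₀) (hδ : 0 < δ) (hA : 0 < A)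
    (hH2 : ∀ t ≥ t₀, ∀ x ≥ (1:ℝ), surv Y (t * x) / surv Y t ≤ A * x ^ (-δ)) :
    ∃ u₀ ∈ Ioo (0:ℝ) 1,
      (∀ u, u₀ ≤ u → u < 1 → ∀ x ≥ (1:ℝ),
        (quant Y u / (1 - u)) * P_Y (quant Y u * x)
          * surv ε (quant X u - β * quant Y u * x)
          ≤ M * A * x ^ (-(1 + δ))) ∧
      IntegrableOn (fun x : ℝ => M * A * x ^ (-(1 + δ))) (Ici (1:ℝ)) := by
  have hc := cdf'_eq_cdf Y hYm
  have hc0 : ∀ y, 0 ≤ cdf' Y y := fun y => ENNReal.toReal_nonneg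
  have hs : ∀ y, 0 < surv Y y := fun y => by unfold surv; linarith [hFY y]
  have hM : ∀ y > (0:ℝ), y * P_Y y / surv Y y ≤ M := fun y hy => by
    rw [hMdef]; exact le_csSup hMfin ⟨y, hy, rfl⟩
  have hM0 : 0 ≤ M := le_trans
    (div_nonneg (mul_nonneg zero_le_one (hPnn 1)) (hs 1).le) (hM 1 one_pos)
  refine ⟨(cdf' Y t₀ + 1) / 2, ⟨by linarith [hc0 t₀], by linarith [hFY t₀]⟩, ?_, ?_⟩
  · intro u hu hu1 x hx
    have hx0 : 0 < x := by linarith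
    have hut : cdf' Y t₀ < u := by linarith [hFY t₀]
    have hmono : ∀ a b, a ≤ b → cdf' Y a ≤ cdf' Y b := fun a b hab => by
      rw [hc, hc]; exact ProbabilityTheory.monotone_cdf _ hab
    have hlow : ∀ z ∈ {z : ℝ | u ≤ cdf' Y z}, t₀ ≤ z := fun z hz => by
      by_contra! h
      have h1 := hmono z t₀ h.le
      have h2 : u ≤ cdf' Y z := hz
      linarith
    have hne : {z : ℝ | u ≤ cdf' Y z}.Nonempty := by
      have ht := ProbabilityTheory.tendsto_cdf_atTop (Measure.map Y (ℙ : Measure Ω))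
      obtain ⟨z, hz⟩ := (ht.eventually (lt_mem_nhds hu1)).exists
      exact ⟨z, by rw [mem_setOf_eq, hc]; exact hz.le⟩
    have hq : t₀ ≤ quant Y u := le_csInf hne hlow
    have hcq : u ≤ cdf' Y (quant Y u) := by
      have hr := (ProbabilityTheory.cdf (Measure.map Y (ℙ : Measure Ω))).right_continuous
        (quant Y u)
      have hr' := hr.tendsto.mono_left (nhdsWithin_mono _ (Ioi_subset_Ici_self))
      rw [hc]
      refine ge_of_tendsto hr' ?_
      filter_upwards [self_mem_nhdsWithin] with z hz
      obtain ⟨w, hw, hwz⟩ := exists_lt_of_csInf_lt hne hz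
      rw [← hc]
      exact le_trans hw (hmono w z hwz.le)
    generalize quant Y u = q at *
    have hq0 : 0 < q := by linarith
    have h1u : 0 < 1 - u := by linarith
    have hsε : surv ε (quant X u - β * q * x) ≤ 1 := by
      have : 0 ≤ cdf' ε (quant X u - β * q * x) := ENNReal.toReal_nonneg
      unfold surv; linarith
    have hsq : surv Y q ≤ 1 - u := by unfold surv; linarith
    have h2 := hH2 q hq x hx
    rw [div_le_iff₀ (hs q)] at h2
    have h3 := hM (q * x) (by positivity)
    rw [div_le_iff₀ (hs _)] at h3
    have hxd : 0 < x ^ (-δ) := Real.rpow_pos_of_pos hx0 _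
    have h4 : surv Y (q * x) ≤ A * x ^ (-δ) * (1 - u) :=
      h2.trans (mul_le_mul_of_nonneg_left hsq (by positivity))
    have h5 : q * x * P_Y (q * x) ≤ M * (A * x ^ (-δ) * (1 - u)) :=
      h3.trans (mul_le_mul_of_nonneg_left h4 hM0)
    have hpow : x ^ (-(1 + δ)) = x ^ (-δ) / x := by
      rw [show -(1 + δ) = -δ - 1 by ring, Real.rpow_sub_one hx0.ne']
    have h6 : 0 ≤ q / (1 - u) * P_Y (q * x) := mul_nonneg (by positivity) (hPnn _)
    refine (mul_le_of_le_one_right h6 hsε).trans ?_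
    rw [hpow, ← mul_div_assoc, div_mul_eq_mul_div, div_le_div_iff₀ h1u hx0]
    linarith
  · rw [integrableOn_Ici_iff_integrableOn_Ioi]
    exact (integrableOn_Ioi_rpow_of_lt (by linarith) one_pos).const_mul _
end

section
/- Let Y and ε be independent real random variables on a probability space (Ω, 𝒜, ℙ), let β > 0 and set X = β·Y + ε. Assume there exist α > 0 and constants C₁ > 0, C₂ > 0 such that y^α·F̄_Y(y) → C₁ as y → ∞ and e^α·F̄_ε(e) → C₂ as e → ∞. Then the ratio of quantile functions converges: lim_{u→1⁻} F_X⁻¹(u)/F_Y⁻¹(u) = β·(1 + C₂/(β^α·C₁))^{1/α}. In particular hypothesis (H3) of the tail-dependence theorem holds with l = β·(1 + C₂/(β^α·C₁))^{1/α}. -/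
open MeasureTheory ProbabilityTheory Filter Set Topology

lemma surv_eq {Ω : Type*} [MeasureSpace Ω] [IsProbabilityMeasure (ℙ : Measure Ω)]
    (Z : Ω → ℝ) (hZ : Measurable Z) (z : ℝ) : surv Z z = (ℙ : Measure Ω).real {ω | z < Z ω} := by
  have h : {ω | z < Z ω} = {ω | Z ω ≤ z}ᶜ := by ext ω; simp
  rw [h, probReal_compl_eq_one_sub (measurableSet_le hZ measurable_const)]
  rfl

lemma surv_anti {Ω : Type*} [MeasureSpace Ω] [IsProbabilityMeasure (ℙ : Measure Ω)]
    (Z : Ω → ℝ) {a b : ℝ} (h : a ≤ b) : surv Z b ≤ surv Z a := by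
  have : cdf' Z a ≤ cdf' Z b :=
    ENNReal.toReal_mono (measure_ne_top _ _) (measure_mono fun ω (hω : Z ω ≤ a) => hω.trans h)
  unfold surv
  linarith

lemma tail_scale {f : ℝ → ℝ} {α C : ℝ}
    (h : Tendsto (fun x : ℝ => x ^ α * f x) atTop (𝓝 C)) {c : ℝ} (hc : 0 < c) :
    Tendsto (fun x : ℝ => x ^ α * f (c * x)) atTop (𝓝 (C / c ^ α)) := by
  have h1 := (h.comp (tendsto_id.const_mul_atTop hc)).div_const (c ^ α)
  refine h1.congr' ?_
  filter_upwards [eventually_gt_atTop 0] with x hx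
  have := Real.rpow_pos_of_pos hc α
  simp only [Function.comp, id]
  rw [Real.mul_rpow hc.le hx.le]
  field_simp

lemma tail_zero {f : ℝ → ℝ} {α C : ℝ} (hα : 0 < α)
    (h : Tendsto (fun x : ℝ => x ^ α * f x) atTop (𝓝 C)) : Tendsto f atTop (𝓝 0) := by
  have h1 := h.mul (tendsto_rpow_neg_atTop hα)
  rw [mul_zero] at h1
  refine h1.congr' ?_
  filter_upwards [eventually_gt_atTop 0] with x hx
  have := Real.rpow_pos_of_pos hx α
  rw [Real.rpow_neg hx.le]
  field_simp

lemma surv_atBot {Ω : Type*} [MeasureSpace Ω] [IsProbabilityMeasure (ℙ : Measure Ω)]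
    (Z : Ω → ℝ) (hZ : Measurable Z) : Tendsto (surv Z) atBot (𝓝 1) := by
  have hp : IsProbabilityMeasure ((ℙ : Measure Ω).map Z) :=
    Measure.isProbabilityMeasure_map hZ.aemeasurable
  have h := (tendsto_cdf_atBot ((ℙ : Measure Ω).map Z)).const_sub 1
  rw [sub_zero] at h
  refine h.congr fun x => ?_
  rw [cdf_eq_real, map_measureReal_apply hZ measurableSet_Iic]
  rfl

lemma tail_sum {Ω : Type*} [MeasureSpace Ω] [IsProbabilityMeasure (ℙ : Measure Ω)]
    (W V : Ω → ℝ) (hW : Measurable W) (hV : Measurable V) (hi : IndepFun W V ℙ)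
    (α : ℝ) (hα : 0 < α) (D E : ℝ)
    (h1 : Tendsto (fun y : ℝ => y ^ α * surv W y) atTop (𝓝 D))
    (h2 : Tendsto (fun y : ℝ => y ^ α * surv V y) atTop (𝓝 E)) :
    Tendsto (fun y : ℝ => y ^ α * surv (fun ω => W ω + V ω) y) atTop (𝓝 (D + E)) := by
  have hind : ∀ a b : ℝ, (ℙ : Measure Ω).real ({ω | a < W ω} ∩ {ω | b < V ω})
      = surv W a * surv V b := by
    intro a b
    rw [surv_eq W hW, surv_eq V hV]
    have := hi.measure_inter_preimage_eq_mul (Ioi a) (Ioi b) measurableSet_Ioi measurableSet_Ioi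
    simp only [measureReal_def, ← ENNReal.toReal_mul]
    exact congrArg _ this
  have hm : ∀ (Z : Ω → ℝ), Measurable Z → ∀ a : ℝ, MeasurableSet {ω | a < Z ω} :=
    fun Z hZ a => measurableSet_lt measurable_const hZ
  have hS := hW.add hV
  have lower : ∀ δ > 0, ∀ x : ℝ, surv W ((1 + δ) * x) * surv V (-δ * x)
      + surv V ((1 + δ) * x) * surv W (-δ * x) - surv W ((1 + δ) * x) * surv V ((1 + δ) * x)
      ≤ surv (fun ω => W ω + V ω) x := by
    intro δ hδ x
    rw [surv_eq (fun ω => W ω + V ω) hS, mul_comm (surv V ((1 + δ) * x)),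
      ← hind, ← hind, ← hind]
    set A := {ω | (1 + δ) * x < W ω} ∩ {ω | -δ * x < V ω}
    set B := {ω | -δ * x < W ω} ∩ {ω | (1 + δ) * x < V ω}
    have e := measureReal_union_add_inter (μ := (ℙ : Measure Ω)) (s := A)
      (((hm W hW _).inter (hm V hV _)) : MeasurableSet B)
    have l1 : (ℙ : Measure Ω).real (A ∪ B) ≤ (ℙ : Measure Ω).real {ω | x < W ω + V ω} := by
      refine measureReal_mono ?_
      rintro ω (⟨a, b⟩ | ⟨a, b⟩) <;> simp only [mem_setOf_eq] at * <;> linarith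
    have l2 : (ℙ : Measure Ω).real (A ∩ B) ≤ (ℙ : Measure Ω).real
        ({ω | (1 + δ) * x < W ω} ∩ {ω | (1 + δ) * x < V ω}) := by
      refine measureReal_mono ?_
      rintro ω ⟨⟨a, b⟩, ⟨c, d⟩⟩
      exact ⟨a, d⟩
    linarith
  have upper : ∀ δ > 0, ∀ x : ℝ, surv (fun ω => W ω + V ω) x ≤
      surv W ((1 - δ) * x) + surv V ((1 - δ) * x) + surv W (δ * x) * surv V (δ * x) := by
    intro δ hδ x
    rw [surv_eq (fun ω => W ω + V ω) hS, ← hind, surv_eq W hW, surv_eq V hV]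
    refine le_trans (measureReal_mono (?_ : _ ⊆ ({ω | (1 - δ) * x < W ω} ∪ {ω | (1 - δ) * x < V ω})
      ∪ ({ω | δ * x < W ω} ∩ {ω | δ * x < V ω}))) ?_
    · intro ω hω
      simp only [mem_union, mem_inter_iff, mem_setOf_eq] at *
      by_contra! hc
      have := hc.2 (by linarith [hc.1.2])
      linarith [hc.1.1]
    · refine (measureReal_union_le _ _).trans ?_
      gcongr
      exact measureReal_union_le _ _
  have hW0 := tail_zero hα h1
  have hV0 := tail_zero hα h2
  have hmt : ∀ c : ℝ, 0 < c → Tendsto (fun x : ℝ => c * x) atTop atTop :=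
    fun c hc => tendsto_id.const_mul_atTop hc
  have hmb : ∀ c : ℝ, 0 < c → Tendsto (fun x : ℝ => -c * x) atTop atBot :=
    fun c hc => tendsto_id.const_mul_atTop_of_neg (by linarith)
  rw [tendsto_order]
  constructor
  · intro a ha
    have hc : Tendsto (fun δ : ℝ => (D + E) / (1 + δ) ^ α) (𝓝[>] 0) (𝓝 (D + E)) := by
      have : ContinuousAt (fun δ : ℝ => (D + E) / (1 + δ) ^ α) 0 := by
        refine ContinuousAt.div continuousAt_const
          (ContinuousAt.rpow_const (by fun_prop) (by simp)) (by simp)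
      have h := this.tendsto
      simp only [add_zero, Real.one_rpow, div_one] at h
      exact h.mono_left nhdsWithin_le_nhds
    obtain ⟨δ, h3, hδ⟩ := ((hc.eventually (lt_mem_nhds ha)).and self_mem_nhdsWithin).exists
    have hδ : 0 < δ := hδ
    have hp : 0 < 1 + δ := by linarith
    have t := (((tail_scale h1 hp).mul ((surv_atBot V hV).comp (hmb δ hδ))).add
      ((tail_scale h2 hp).mul ((surv_atBot W hW).comp (hmb δ hδ)))).sub
      ((tail_scale h1 hp).mul (hV0.comp (hmt _ hp)))
    rw [mul_one, mul_one, mul_zero, sub_zero, ← add_div] at t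
    filter_upwards [t.eventually (lt_mem_nhds h3), eventually_gt_atTop 0] with x hx hx0
    refine hx.trans_le ?_
    have := mul_le_mul_of_nonneg_left (lower δ hδ x) (Real.rpow_nonneg hx0.le α)
    simp only [Function.comp]
    linarith
  · intro a ha
    have hc : Tendsto (fun δ : ℝ => (D + E) / (1 - δ) ^ α) (𝓝[>] 0) (𝓝 (D + E)) := by
      have : ContinuousAt (fun δ : ℝ => (D + E) / (1 - δ) ^ α) 0 := by
        refine ContinuousAt.div continuousAt_const
          (ContinuousAt.rpow_const (by fun_prop) (by simp)) (by simp)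
      have h := this.tendsto
      simp only [sub_zero, Real.one_rpow, div_one] at h
      exact h.mono_left nhdsWithin_le_nhds
    obtain ⟨δ, h3, hδ, hδ1⟩ := ((hc.eventually (gt_mem_nhds ha)).and
      (Ioo_mem_nhdsGT (zero_lt_one (α := ℝ)))).exists
    have hp : 0 < 1 - δ := by linarith
    have t := ((tail_scale h1 hp).add (tail_scale h2 hp)).add
      ((tail_scale h1 hδ).mul (hV0.comp (hmt _ hδ)))
    rw [mul_zero, add_zero, ← add_div] at t
    filter_upwards [t.eventually (gt_mem_nhds h3), eventually_gt_atTop 0] with x hx hx0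
    refine lt_of_le_of_lt ?_ hx
    have := mul_le_mul_of_nonneg_left (upper δ hδ x) (Real.rpow_nonneg hx0.le α)
    simp only [Function.comp]
    linarith

lemma quant_asymp {Ω : Type*} [MeasureSpace Ω] [IsProbabilityMeasure (ℙ : Measure Ω)]
    (Z : Ω → ℝ) (α : ℝ) (hα : 0 < α) (C : ℝ) (hC : 0 < C)
    (h : Tendsto (fun y : ℝ => y ^ α * surv Z y) atTop (𝓝 C)) :
    Tendsto (fun u => quant Z u / (1 - u) ^ (-(1 / α))) (𝓝[<] (1:ℝ)) (𝓝 (C ^ (1 / α))) := by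
  have h0 : Tendsto (fun u : ℝ => 1 - u) (𝓝[<] 1) (𝓝[>] 0) := by
    refine tendsto_nhdsWithin_iff.2 ⟨?_, ?_⟩
    · have : ContinuousAt (fun u : ℝ => 1 - u) 1 := by fun_prop
      have h := this.tendsto
      rw [sub_self] at h
      exact h.mono_left nhdsWithin_le_nhds
    · filter_upwards [self_mem_nhdsWithin] with u hu
      have : u < 1 := hu
      simpa using this
  have ht : Tendsto (fun u : ℝ => (1 - u) ^ (-(1 / α))) (𝓝[<] 1) atTop := by
    refine ((tendsto_rpow_atTop (y := 1 / α) (by positivity)).comp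
      (tendsto_inv_nhdsGT_zero.comp h0)).congr' ?_
    filter_upwards [self_mem_nhdsWithin] with u hu
    have : u < 1 := hu
    simp only [Function.comp]
    rw [Real.rpow_neg (by linarith), Real.inv_rpow (by linarith)]
  have hK : 0 < C ^ (1 / α) := Real.rpow_pos_of_pos hC _
  have hKα : (C ^ (1 / α)) ^ α = C := by
    rw [← Real.rpow_mul hC.le, one_div_mul_cancel hα.ne', Real.rpow_one]
  have key : ∀ c > 0, Tendsto (fun u : ℝ => surv Z (c * (1 - u) ^ (-(1 / α))) / (1 - u))
      (𝓝[<] 1) (𝓝 (C / c ^ α)) := by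
    intro c hc
    refine ((tail_scale h hc).comp ht).congr' ?_
    filter_upwards [self_mem_nhdsWithin] with u hu
    have hu : 0 < 1 - u := by have : u < 1 := hu; linarith
    simp only [Function.comp]
    rw [← Real.rpow_mul hu.le, neg_mul, one_div_mul_cancel hα.ne', Real.rpow_neg_one]
    field_simp
  have lo : ∀ a, 0 < a → a < C ^ (1 / α) → ∀ᶠ u in 𝓝[<] (1:ℝ),
      ∀ z, u ≤ cdf' Z z → a * (1 - u) ^ (-(1 / α)) ≤ z := by
    intro a ha hac
    have hlt : 1 < C / a ^ α := by
      rw [one_lt_div (Real.rpow_pos_of_pos ha _)]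
      calc a ^ α < (C ^ (1 / α)) ^ α := Real.rpow_lt_rpow ha.le hac hα
        _ = C := hKα
    filter_upwards [(key a ha).eventually (lt_mem_nhds hlt), self_mem_nhdsWithin] with u hu hu1 z hz
    have hu1 : 0 < 1 - u := by have : u < 1 := hu1; linarith
    rw [one_lt_div hu1] at hu
    by_contra! hc
    have := surv_anti Z hc.le
    have e : surv Z z = 1 - cdf' Z z := rfl
    linarith
  have hi : ∀ b, C ^ (1 / α) < b → ∀ᶠ u in 𝓝[<] (1:ℝ),
      u ≤ cdf' Z (b * (1 - u) ^ (-(1 / α))) := by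
    intro b hb
    have hb0 := hK.trans hb
    have hlt : C / b ^ α < 1 := by
      rw [div_lt_one (Real.rpow_pos_of_pos hb0 _)]
      calc C = (C ^ (1 / α)) ^ α := hKα.symm
        _ < b ^ α := Real.rpow_lt_rpow hK.le hb hα
    filter_upwards [(key b hb0).eventually (gt_mem_nhds hlt), self_mem_nhdsWithin] with u hu hu1
    have hu1 : 0 < 1 - u := by have : u < 1 := hu1; linarith
    rw [div_lt_one hu1] at hu
    have e : surv Z (b * (1 - u) ^ (-(1 / α))) = 1 - cdf' Z (b * (1 - u) ^ (-(1 / α))) := rfl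
    linarith
  rw [tendsto_order]
  constructor
  · intro a ha
    obtain ⟨a', ha1, ha2⟩ := exists_between (max_lt ha hK)
    filter_upwards [lo a' ((le_max_right _ _).trans_lt ha1) ha2,
      hi (C ^ (1 / α) + 1) (by linarith), ht.eventually (eventually_gt_atTop 0)] with u h1 h2 h3
    rw [lt_div_iff₀ h3]
    have : a' * (1 - u) ^ (-(1 / α)) ≤ quant Z u := le_csInf ⟨_, h2⟩ h1
    have := mul_lt_mul_of_pos_right ((le_max_left _ _).trans_lt ha1) h3
    linarith
  · intro b hb
    obtain ⟨b', hb1, hb2⟩ := exists_between hb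
    filter_upwards [lo (C ^ (1 / α) / 2) (by positivity) (by linarith),
      hi b' hb1, ht.eventually (eventually_gt_atTop 0)] with u h1 h2 h3
    rw [div_lt_iff₀ h3]
    have : quant Z u ≤ b' * (1 - u) ^ (-(1 / α)) := csInf_le ⟨_, h1⟩ h2
    have := mul_lt_mul_of_pos_right hb2 h3
    linarith

/-- Under common power-law tails with index `α`, the ratio of quantile functions
converges: `F_X⁻¹(u)/F_Y⁻¹(u) → β·(1 + C₂/(β^α·C₁))^{1/α}` as `u → 1⁻`,
establishing hypothesis (H3) with `l = β·(1 + C₂/(β^α·C₁))^{1/α}`. -/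
theorem quantile_ratio_limit
    {Ω : Type*} [MeasureSpace Ω] [IsProbabilityMeasure (ℙ : Measure Ω)]
    (Y ε X : Ω → ℝ) (hYm : Measurable Y) (hεm : Measurable ε)
    (hindep : IndepFun Y ε ℙ)
    (β : ℝ) (hβ : 0 < β)
    (hXdef : ∀ ω, X ω = β * Y ω + ε ω)
    (α : ℝ) (hα : 0 < α)
    (C₁ C₂ : ℝ) (hC₁ : 0 < C₁) (hC₂ : 0 < C₂)
    (hY : Tendsto (fun y : ℝ => y ^ α * surv Y y) atTop (𝓝 C₁))
    (hε : Tendsto (fun e : ℝ => e ^ α * surv ε e) atTop (𝓝 C₂)) :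
    Tendsto (fun u => quant X u / quant Y u) (𝓝[<] (1:ℝ))
      (𝓝 (β * (1 + C₂ / (β ^ α * C₁)) ^ (1 / α))) := by
  have hβα := Real.rpow_pos_of_pos hβ α
  have hW : Tendsto (fun y : ℝ => y ^ α * surv (fun ω => β * Y ω) y) atTop
      (𝓝 (β ^ α * C₁)) := by
    have h := tail_scale hY (inv_pos.2 hβ)
    rw [Real.inv_rpow hβ.le, div_inv_eq_mul, mul_comm] at h
    refine h.congr fun y => ?_
    have : surv Y (β⁻¹ * y) = surv (fun ω => β * Y ω) y := by
      unfold surv cdf'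
      have : {ω | Y ω ≤ β⁻¹ * y} = {ω | β * Y ω ≤ y} := by
        ext ω
        simp only [mem_setOf_eq]
        exact le_inv_mul_iff₀ hβ
      rw [this]
    rw [this]
  have hi : IndepFun (fun ω => β * Y ω) ε ℙ :=
    hindep.comp (φ := fun y => β * y) (ψ := id) (by fun_prop) measurable_id
  have hX := tail_sum _ ε (hYm.const_mul β) hεm hi α hα _ _ hW hε
  obtain rfl : X = fun ω => β * Y ω + ε ω := funext hXdef
  have hK : 0 < β ^ α * C₁ + C₂ := by positivity
  have q := (quant_asymp _ α hα _ hK hX).div (quant_asymp Y α hα C₁ hC₁ hY)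
    (Real.rpow_pos_of_pos hC₁ _).ne'
  have hval : (β ^ α * C₁ + C₂) ^ (1 / α) / C₁ ^ (1 / α)
      = β * (1 + C₂ / (β ^ α * C₁)) ^ (1 / α) := by
    have e : (β ^ α * C₁ + C₂) = β ^ α * (1 + C₂ / (β ^ α * C₁)) * C₁ := by
      field_simp
    have e2 : (β ^ α) ^ (1 / α) = β := by
      rw [← Real.rpow_mul hβ.le, mul_one_div_cancel hα.ne', Real.rpow_one]
    rw [e, Real.mul_rpow (by positivity) hC₁.le, Real.mul_rpow hβα.le (by positivity), e2,
      mul_div_cancel_right₀ _ (Real.rpow_pos_of_pos hC₁ _).ne']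
  rw [hval] at q
  refine q.congr' ?_
  filter_upwards [self_mem_nhdsWithin] with u hu
  have hu : 0 < 1 - u := by have : u < 1 := hu; linarith
  exact div_div_div_cancel_right₀ (Real.rpow_pos_of_pos hu _).ne' _ _
end
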